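/- Let (W,S) be a finite Coxeter system with standard Coxeter element c, and let v, w ∈ NC(W,c) with v ≪ w (where ≪ is the transitive closure of: for absolute covers u ⋖ u′, u ≪· u′ iff u′ <_B u). Then supp(v) = supp(w). Consequently, the connected components of the poset (NC(W,c), ≪) are exactly the 2^n sets {w ∈ NC(W,c) : supp(w) = J} for J ⊆ S appearing as a support, and interval partitions (elements w with w ≤_B c) are the maximal elements for ≪. -/

import Mathlib

namespace NCpaper

open CoxeterSystem

variable {B : Type*} {W : Type*} [Group W] {M : CoxeterMatrix B}

/-- The absolute length: minimal length of a factorization into reflections. -/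
noncomputable def absLength (cs : CoxeterSystem M W) (w : W) : ℕ :=
  sInf {k | ∃ l : List W, (∀ t ∈ l, cs.IsReflection t) ∧ l.length = k ∧ l.prod = w}

/-- The absolute order: `v ≤ w` iff `ℓ_T w = ℓ_T (v⁻¹ w) + ℓ_T v`. -/
noncomputable def AbsLe (cs : CoxeterSystem M W) (v w : W) : Prop :=
  absLength cs w = absLength cs (v⁻¹ * w) + absLength cs v

/-- Cover relation of the absolute order. -/
noncomputable def AbsCovBy (cs : CoxeterSystem M W) (v w : W) : Prop :=
  cs.IsReflection (v⁻¹ * w) ∧ absLength cs w = absLength cs v + 1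

/-- Generating relation of the Bruhat order: multiply by a reflection, length goes up. -/
def BruhatGen (cs : CoxeterSystem M W) (v w : W) : Prop :=
  cs.IsReflection (v⁻¹ * w) ∧ cs.length v < cs.length w

/-- The Bruhat order. -/
def BruhatLe (cs : CoxeterSystem M W) : W → W → Prop := Relation.ReflTransGen (BruhatGen cs)

/-- The strict Bruhat order. -/
def BruhatLt (cs : CoxeterSystem M W) : W → W → Prop := Relation.TransGen (BruhatGen cs)

/-- The support of an element: simple reflections occurring in every (equivalently, some)
reduced word for it. -/
def supp (cs : CoxeterSystem M W) (w : W) : Set B :=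
  {i | ∀ l : List B, cs.IsReduced l → cs.wordProd l = w → i ∈ l}

/-- A standard Coxeter element: the product of all the simple reflections, each once,
in some order. -/
def IsStdCoxeterElement (cs : CoxeterSystem M W) (c : W) : Prop :=
  ∃ l : List B, l.Nodup ∧ (∀ i : B, i ∈ l) ∧ cs.wordProd l = c

/-- Generating relation for the order `⊏`: an absolute-order cover which is Bruhat-increasing. -/
noncomputable def SqGen (cs : CoxeterSystem M W) (v w : W) : Prop :=
  AbsCovBy cs v w ∧ BruhatLt cs v w

/-- The order `⊏`. -/
noncomputable def Sq (cs : CoxeterSystem M W) : W → W → Prop :=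
  Relation.ReflTransGen (SqGen cs)

/-- Generating relation for the order `≪`: an absolute-order cover which is Bruhat-decreasing. -/
noncomputable def LlGen (cs : CoxeterSystem M W) (v w : W) : Prop :=
  AbsCovBy cs v w ∧ BruhatLt cs w v

/-- The order `≪`. -/
noncomputable def Ll (cs : CoxeterSystem M W) : W → W → Prop :=
  Relation.ReflTransGen (LlGen cs)


/-! ### The geometric representation -/

/-- The Gram matrix of the geometric representation. -/
noncomputable def gram (M : CoxeterMatrix B) : Matrix B B ℝ :=
  Matrix.of fun i j => -Real.cos (Real.pi / M i j)

theorem gram_symm (M : CoxeterMatrix B) (i j : B) : gram M i j = gram M j i := by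
  simp [gram, M.symmetric i j]

theorem gram_diag (M : CoxeterMatrix B) (i : B) : gram M i i = 1 := by
  simp [gram]

/-- The simple root. -/
noncomputable def sr (i : B) : B → ℝ := by
  classical exact Pi.single i 1

theorem sr_same (i : B) : sr i i = 1 := by simp [sr]

theorem sr_ne {i j : B} (h : j ≠ i) : sr i j = 0 := by simp [sr, h]

theorem sr_nonneg (i : B) : 0 ≤ sr i := by
  intro j
  by_cases h : j = i
  · subst h; simp [sr_same]
  · simp [sr_ne h]

section rep

variable [Fintype B]

/-- The bilinear form. -/
noncomputable def bf (M : CoxeterMatrix B) : (B → ℝ) →ₗ[ℝ] (B → ℝ) →ₗ[ℝ] ℝ :=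
  LinearMap.mk₂ ℝ (fun v w => ∑ i, ∑ j, v i * w j * gram M i j)
    (by intros; simp [add_mul, Finset.sum_add_distrib])
    (by intros; simp [Finset.mul_sum, mul_assoc])
    (by intros; simp [add_mul, mul_add, Finset.sum_add_distrib])
    (by intros; simp [Finset.mul_sum, mul_left_comm, mul_assoc])

theorem bf_apply (M : CoxeterMatrix B) (v w : B → ℝ) :
    bf M v w = ∑ i, ∑ j, v i * w j * gram M i j := rfl

theorem bf_symm (M : CoxeterMatrix B) (v w : B → ℝ) : bf M v w = bf M w v := by
  rw [bf_apply, bf_apply, Finset.sum_comm]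
  refine Finset.sum_congr rfl fun i _ => Finset.sum_congr rfl fun j _ => ?_
  rw [gram_symm]; ring

theorem bf_sr (M : CoxeterMatrix B) (i j : B) : bf M (sr i) (sr j) = gram M i j := by
  classical
  rw [bf_apply, Finset.sum_eq_single i, Finset.sum_eq_single j]
  · simp [sr_same]
  · intro b _ hb; simp [sr_ne hb]
  · simp
  · intro b _ hb; simp [sr_ne hb]
  · simp

theorem bf_sr_self (M : CoxeterMatrix B) (i : B) : bf M (sr i) (sr i) = 1 := by
  rw [bf_sr, gram_diag]

/-- The simple reflection as a linear map. -/
noncomputable def srefl (M : CoxeterMatrix B) (i : B) : (B → ℝ) →ₗ[ℝ] (B → ℝ) :=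
  LinearMap.id - (2 : ℝ) • (bf M (sr i)).smulRight (sr i)

theorem srefl_apply (M : CoxeterMatrix B) (i : B) (v : B → ℝ) :
    srefl M i v = v - (2 * bf M (sr i) v) • sr i := by
  simp [srefl, mul_smul]

theorem srefl_self (M : CoxeterMatrix B) (i : B) : srefl M i (sr i) = - sr i := by
  rw [srefl_apply, bf_sr_self]; module

theorem srefl_sr (M : CoxeterMatrix B) (i j : B) :
    srefl M i (sr j) = sr j + (2 * Real.cos (Real.pi / M i j)) • sr i := by
  rw [srefl_apply, bf_sr]; simp [gram]

theorem srefl_sq (M : CoxeterMatrix B) (i : B) (v : B → ℝ) : srefl M i (srefl M i v) = v := by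
  rw [srefl_apply M i v, map_sub, map_smul, srefl_self, srefl_apply]; module

/-- Chebyshev type sequence. -/
noncomputable def cheb (a : ℝ) : ℕ → ℝ
  | 0 => 0
  | 1 => 1
  | (k + 2) => a * cheb a (k + 1) - cheb a k

theorem cheb_rec (a : ℝ) (k : ℕ) : cheb a (k + 2) = a * cheb a (k + 1) - cheb a k := by
  rw [cheb]

theorem cheb_sin (x : ℝ) : ∀ k : ℕ, cheb (2 * Real.cos x) k * Real.sin x = Real.sin (k * x)
  | 0 => by simp [cheb]
  | 1 => by simp [cheb]
  | (k + 2) => by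
    have h1 := cheb_sin x (k + 1)
    have h0 := cheb_sin x k
    rw [cheb, sub_mul, mul_assoc, h1, h0]
    push_cast
    have e1 : ((k : ℝ) + 2) * x = (k + 1) * x + x := by ring
    have e2 : (k : ℝ) * x = (k + 1) * x - x := by ring
    rw [e1, e2, Real.sin_add, Real.sin_sub]; ring

theorem cheb_two : ∀ k : ℕ, cheb 2 k = k
  | 0 => by simp [cheb]
  | 1 => by simp [cheb]
  | (k + 2) => by
    rw [cheb, cheb_two (k + 1), cheb_two k]; push_cast; ring

theorem sin_pi_div_pos {m : ℕ} (hm : 2 ≤ m) : 0 < Real.sin (Real.pi / m) := by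
  have : (2 : ℝ) ≤ m := by exact_mod_cast hm
  apply Real.sin_pos_of_pos_of_lt_pi
  · have := Real.pi_pos; positivity
  · rw [div_lt_iff₀ (by linarith)]; nlinarith [Real.pi_pos]

theorem cheb_nonneg (m : ℕ) (hm : m ≠ 1) (k : ℕ) (hk : m ≠ 0 → k ≤ m) :
    0 ≤ cheb (2 * Real.cos (Real.pi / m)) k := by
  rcases Nat.eq_zero_or_pos m with rfl | h
  · simp [cheb_two]
  · have h2 : 2 ≤ m := by omega
    have hs := sin_pi_div_pos h2
    have := cheb_sin (Real.pi / m) k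
    have hk' : (k : ℝ) ≤ m := by exact_mod_cast hk (by omega)
    have hm' : (0 : ℝ) < m := by exact_mod_cast h
    have h3 : 0 ≤ Real.sin (k * (Real.pi / m)) := by
      apply Real.sin_nonneg_of_nonneg_of_le_pi
      · have := Real.pi_pos; positivity
      · rw [← mul_div_assoc, div_le_iff₀ hm']; nlinarith [Real.pi_pos]
    rw [← this] at h3
    exact nonneg_of_mul_nonneg_left h3 hs

theorem srefl_mul_pow_sr (M : CoxeterMatrix B) (i j : B) (k : ℕ) :
    ((srefl M i * srefl M j) ^ k) (sr i) =
      cheb (2 * Real.cos (Real.pi / M i j)) (2 * k + 1) • sr i +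
      cheb (2 * Real.cos (Real.pi / M i j)) (2 * k) • sr j := by
  induction k with
  | zero => simp [cheb]
  | succ k ih =>
    rw [pow_succ', Module.End.mul_apply, ih]
    have e1 : 2 * (k + 1) + 1 = (2 * k + 1) + 2 := by ring
    have e2 : 2 * (k + 1) = (2 * k) + 2 := by ring
    rw [e1, e2, cheb_rec _ (2 * k + 1), cheb_rec _ (2 * k)]
    simp only [Module.End.mul_apply, map_add, map_smul, srefl_self, srefl_sr, map_neg,
      M.symmetric j i]
    module

theorem srefl_mul_pow (M : CoxeterMatrix B) (i j : B) :
    (srefl M i * srefl M j) ^ M i j = 1 := by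
  by_cases hij : i = j
  · subst hij
    rw [M.diagonal]; ext1 v; simp [srefl_sq]
  rcases Nat.eq_zero_or_pos (M i j) with h0 | hpos
  · simp [h0]
  have h2 : 2 ≤ M i j := by have := M.off_diagonal i j hij; omega
  have hs := sin_pi_div_pos h2
  have key : ∀ i j : B, i ≠ j → 2 ≤ M i j → ((srefl M i * srefl M j) ^ M i j) (sr i) = sr i := by
    intro i j hij h2
    have hs := sin_pi_div_pos h2
    have hm : (M i j : ℝ) ≠ 0 := by
      have : (0 : ℝ) < M i j := by exact_mod_cast (by omega : 0 < M i j)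
      exact this.ne'
    rw [srefl_mul_pow_sr]
    have c1 : cheb (2 * Real.cos (Real.pi / M i j)) (2 * M i j + 1) = 1 := by
      have := cheb_sin (Real.pi / M i j) (2 * M i j + 1)
      push_cast at this
      rw [show (2 * (M i j : ℝ) + 1) * (Real.pi / M i j) = Real.pi / M i j + 2 * Real.pi by
        field_simp; ring, Real.sin_add_two_pi] at this
      exact mul_right_cancel₀ hs.ne' (by linarith)
    have c2 : cheb (2 * Real.cos (Real.pi / M i j)) (2 * M i j) = 0 := by
      have := cheb_sin (Real.pi / M i j) (2 * M i j)
      push_cast at this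
      rw [show (2 * (M i j : ℝ)) * (Real.pi / M i j) = 2 * Real.pi by
        field_simp, Real.sin_two_pi] at this
      exact mul_right_cancel₀ hs.ne' (by linarith)
    rw [c1, c2]; simp
  have hi := key i j hij h2
  have hj : ((srefl M i * srefl M j) ^ M i j) (sr j) = sr j := by
    have h := key j i (Ne.symm hij) (by rwa [M.symmetric j i])
    rw [M.symmetric j i] at h
    have h1 : (srefl M i * srefl M j) * (srefl M j * srefl M i) = 1 := by
      ext1 v; simp [srefl_sq]
    have h1' : (srefl M j * srefl M i) * (srefl M i * srefl M j) = 1 := by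
      ext1 v; simp [srefl_sq]
    have h3 : (srefl M i * srefl M j) ^ M i j * (srefl M j * srefl M i) ^ M i j = 1 := by
      have hc : Commute (srefl M i * srefl M j) (srefl M j * srefl M i) := by
        rw [Commute, SemiconjBy, h1, h1']
      rw [← hc.mul_pow, h1, one_pow]
    calc _ = ((srefl M i * srefl M j) ^ M i j) (((srefl M j * srefl M i) ^ M i j) (sr j)) := by
            rw [h]
      _ = ((srefl M i * srefl M j) ^ M i j * (srefl M j * srefl M i) ^ M i j) (sr j) := rfl
      _ = _ := by rw [h3]; rfl
  ext1 v
  set b := gram M i j with hb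
  have hb2 : 1 - b ^ 2 ≠ 0 := by
    have : 1 - b ^ 2 = Real.sin (Real.pi / M i j) ^ 2 := by
      rw [hb, Real.sin_sq]; simp [gram]
    rw [this]; positivity
  set p := bf M (sr i) v with hp
  set q := bf M (sr j) v with hq
  set x := (p - b * q) / (1 - b ^ 2) with hx
  set y := (q - b * p) / (1 - b ^ 2) with hy
  set v0 := v - x • sr i - y • sr j with hv0
  have f1 : srefl M i v0 = v0 := by
    have : bf M (sr i) v0 = 0 := by
      rw [hv0]; simp only [map_sub, map_smul, bf_sr, gram_diag, ← hp, ← hb, smul_eq_mul]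
      rw [hx, hy]; field_simp; ring
    rw [srefl_apply, this]; simp
  have f2 : srefl M j v0 = v0 := by
    have : bf M (sr j) v0 = 0 := by
      rw [hv0]; simp only [map_sub, map_smul, bf_sr, gram_diag, ← hq, gram_symm M j i, ← hb,
        smul_eq_mul]
      rw [hx, hy]; field_simp; ring
    rw [srefl_apply, this]; simp
  have f3 : ∀ k : ℕ, ((srefl M i * srefl M j) ^ k) v0 = v0 := by
    intro k
    induction k with
    | zero => simp
    | succ k ih => rw [pow_succ, Module.End.mul_apply, Module.End.mul_apply, f2, f1, ih]
  have hv : v = v0 + x • sr i + y • sr j := by rw [hv0]; module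
  rw [hv]
  simp only [map_add, map_smul, hi, hj, f3, Module.End.one_apply]

/-- The geometric representation. -/
noncomputable def rep (cs : CoxeterSystem M W) : W →* Module.End ℝ (B → ℝ) :=
  cs.lift ⟨srefl M, fun i j => srefl_mul_pow M i j⟩

theorem rep_simple (cs : CoxeterSystem M W) (i : B) : rep cs (cs.simple i) = srefl M i :=
  cs.lift_apply_simple _ i

theorem rep_mul (cs : CoxeterSystem M W) (x y : W) (v : B → ℝ) :
    rep cs (x * y) v = rep cs x (rep cs y v) := by
  rw [map_mul]; rfl

theorem rep_inv_cancel (cs : CoxeterSystem M W) (x : W) (v : B → ℝ) :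
    rep cs x⁻¹ (rep cs x v) = v := by
  rw [← rep_mul]; simp

theorem rep_cancel_inv (cs : CoxeterSystem M W) (x : W) (v : B → ℝ) :
    rep cs x (rep cs x⁻¹ v) = v := by
  rw [← rep_mul]; simp

theorem bf_srefl (M : CoxeterMatrix B) (i : B) (v w : B → ℝ) :
    bf M (srefl M i v) (srefl M i w) = bf M v w := by
  rw [srefl_apply, srefl_apply]
  simp only [map_sub, map_smul, LinearMap.sub_apply, LinearMap.smul_apply, bf_sr_self, smul_eq_mul]
  rw [bf_symm M v (sr i)]; ring

theorem bf_rep (cs : CoxeterSystem M W) (x : W) (v w : B → ℝ) :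
    bf M (rep cs x v) (rep cs x w) = bf M v w := by
  induction x using cs.simple_induction_left with
  | one => simp
  | mul_simple_left x i ih => rw [rep_mul, rep_mul, rep_simple, bf_srefl, ih]

/-! ### Positivity of roots -/

theorem rep_alt (cs : CoxeterSystem M W) (i j : B) (k : ℕ) :
    (rep cs (cs.wordProd (alternatingWord i j (2 * k))) (sr i) =
      cheb (2 * Real.cos (Real.pi / M i j)) (2 * k + 1) • sr i +
      cheb (2 * Real.cos (Real.pi / M i j)) (2 * k) • sr j) ∧
    (rep cs (cs.wordProd (alternatingWord i j (2 * k + 1))) (sr i) =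
      cheb (2 * Real.cos (Real.pi / M i j)) (2 * k + 1) • sr i +
      cheb (2 * Real.cos (Real.pi / M i j)) (2 * k + 2) • sr j) := by
  induction k generalizing i j with
  | zero =>
    constructor
    · simp [alternatingWord, cheb]
    · simp [alternatingWord, cheb, rep_simple, srefl_sr, M.symmetric j i]
  | succ k ih =>
    have step : ∀ (i j : B) (n : ℕ),
        rep cs (cs.wordProd (alternatingWord i j (n + 2))) (sr i) =
        - rep cs (cs.wordProd (alternatingWord i j n)) (sr i) +
        (2 * Real.cos (Real.pi / M i j)) •
          rep cs (cs.wordProd (alternatingWord j i (n + 1))) (sr j) := by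
      intro i j n
      rw [alternatingWord_succ i j (n + 1), cs.wordProd_concat, rep_mul, rep_simple, srefl_sr,
        map_add, map_smul, M.symmetric j i]
      congr 1
      rw [alternatingWord_succ j i n, cs.wordProd_concat, rep_mul, rep_simple, srefl_self, map_neg]
    have h1 : rep cs (cs.wordProd (alternatingWord i j (2 * (k + 1)))) (sr i) =
      cheb (2 * Real.cos (Real.pi / M i j)) (2 * (k + 1) + 1) • sr i +
      cheb (2 * Real.cos (Real.pi / M i j)) (2 * (k + 1)) • sr j := by
      have e : 2 * (k + 1) = 2 * k + 2 := by ring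
      rw [e, step, (ih i j).1, (ih j i).2, M.symmetric j i]
      rw [show 2 * k + 2 + 1 = (2 * k + 1) + 2 by ring, cheb_rec _ (2 * k + 1), cheb_rec _ (2 * k)]
      module
    have h2 : rep cs (cs.wordProd (alternatingWord j i (2 * (k + 1)))) (sr j) =
      cheb (2 * Real.cos (Real.pi / M i j)) (2 * (k + 1) + 1) • sr j +
      cheb (2 * Real.cos (Real.pi / M i j)) (2 * (k + 1)) • sr i := by
      have e : 2 * (k + 1) = 2 * k + 2 := by ring
      rw [e, step, (ih i j).2, (ih j i).1, M.symmetric j i]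
      rw [show 2 * k + 2 + 1 = (2 * k + 1) + 2 by ring, cheb_rec _ (2 * k + 1), cheb_rec _ (2 * k)]
      module
    refine ⟨h1, ?_⟩
    rw [show 2 * (k + 1) + 1 = (2 * k + 1) + 2 by ring, step, (ih i j).2,
      show 2 * k + 1 + 1 = 2 * (k + 1) by ring, h2,
      show 2 * (k + 1) + 2 = (2 * k + 2) + 2 by ring, cheb_rec _ (2 * k + 2),
      show 2 * (k + 1) + 1 = (2 * k + 1) + 2 by ring,
      show 2 * k + 2 + 1 = (2 * k + 1) + 2 by ring,
      show 2 * (k + 1) = 2 * k + 2 by ring, cheb_rec _ (2 * k + 1), cheb_rec _ (2 * k)]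
    module

set_option linter.unusedSectionVars false in
theorem exists_alt_factor (cs : CoxeterSystem M W) (n : ℕ) : ∀ (w : W) (i j : B),
    cs.length w = n → ¬ cs.IsRightDescent w i →
    ∃ (k : ℕ) (v : W), w = v * cs.wordProd (alternatingWord i j k) ∧
      cs.length w = cs.length v + k ∧ ¬ cs.IsRightDescent v i ∧ ¬ cs.IsRightDescent v j := by
  induction n with
  | zero =>
    intro w i j hn hi
    refine ⟨0, w, by simp [alternatingWord], by simp, hi, ?_⟩
    unfold CoxeterSystem.IsRightDescent; omega
  | succ n ih =>
    intro w i j hn hi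
    by_cases hj : cs.IsRightDescent w j
    · have h1 := cs.isRightDescent_iff.1 hj
      have h2 : ¬ cs.IsRightDescent (w * cs.simple j) j :=
        (cs.isRightDescent_iff_not_isRightDescent_mul).1 hj
      obtain ⟨k, v, e1, e2, e3, e4⟩ := ih (w * cs.simple j) j i (by omega) h2
      refine ⟨k + 1, v, ?_, by omega, e4, e3⟩
      rw [alternatingWord_succ, cs.wordProd_concat, ← mul_assoc, ← e1]; simp
    · exact ⟨0, w, by simp [alternatingWord], by simp, hi, hj⟩

theorem rep_pos (cs : CoxeterSystem M W) (n : ℕ) : ∀ (w : W) (i : B),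
    cs.length w = n → ¬ cs.IsRightDescent w i → 0 ≤ rep cs w (sr i) := by
  induction n using Nat.strong_induction_on with
  | _ n ih =>
    intro w i hn hi
    by_cases hw : w = 1
    · subst hw; simpa using sr_nonneg i
    obtain ⟨j, hj⟩ := cs.exists_rightDescent_of_ne_one hw
    have hij : i ≠ j := by rintro rfl; exact hi hj
    obtain ⟨k, v, e1, e2, e3, e4⟩ := exists_alt_factor cs n w i j hn hi
    have hk : k ≠ 0 := by
      rintro rfl
      simp [alternatingWord] at e1
      subst e1; exact e4 hj
    have p1 := ih (cs.length v) (by omega) v i rfl e3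
    have p2 := ih (cs.length v) (by omega) v j rfl e4
    have hm1 : M i j ≠ 1 := M.off_diagonal i j hij
    have hkm : M i j ≠ 0 → k + 1 ≤ M i j := by
      intro h0
      by_contra hlt
      have hnr := cs.not_isReduced_alternatingWord j i (m := k + 1)
        (by rwa [M.symmetric j i]) (by rw [M.symmetric j i]; omega)
      have l1 := cs.not_isRightDescent_iff.1 hi
      have l2 : w * cs.simple i = v * cs.wordProd (alternatingWord j i (k + 1)) := by
        rw [alternatingWord_succ, cs.wordProd_concat, ← mul_assoc, ← e1]
      have l3 := cs.length_mul_le v (cs.wordProd (alternatingWord j i (k + 1)))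
      have l4 := cs.length_wordProd_le (alternatingWord j i (k + 1))
      rw [length_alternatingWord] at l4
      apply hnr
      unfold CoxeterSystem.IsReduced
      rw [length_alternatingWord]
      rw [l2] at l1
      omega
    have c0 := cheb_nonneg (M i j) hm1 k (fun h => by have := hkm h; omega)
    have c1 := cheb_nonneg (M i j) hm1 (k + 1) hkm
    rw [e1, rep_mul]
    rcases Nat.even_or_odd' k with ⟨r, rfl | rfl⟩
    · rw [(rep_alt cs i j r).1, map_add, map_smul, map_smul]
      exact add_nonneg (smul_nonneg c1 p1) (smul_nonneg c0 p2)
    · rw [(rep_alt cs i j r).2, map_add, map_smul, map_smul]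
      exact add_nonneg (smul_nonneg c0 p1) (smul_nonneg c1 p2)

theorem rep_nonneg (cs : CoxeterSystem M W) {w : W} {i : B} (h : ¬ cs.IsRightDescent w i) :
    0 ≤ rep cs w (sr i) := rep_pos cs _ w i rfl h

theorem rep_nonpos (cs : CoxeterSystem M W) {w : W} {i : B} (h : cs.IsRightDescent w i) :
    rep cs w (sr i) ≤ 0 := by
  have h2 := rep_nonneg cs ((cs.isRightDescent_iff_not_isRightDescent_mul).1 h)
  rw [rep_mul, rep_simple, srefl_self, map_neg] at h2
  simpa using h2

theorem rep_injective (cs : CoxeterSystem M W) {x y : W} (h : ∀ v, rep cs x v = rep cs y v) :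
    x = y := by
  by_contra hne
  have hne' : x⁻¹ * y ≠ 1 := by
    intro h1; apply hne; rw [inv_mul_eq_one] at h1; exact h1
  obtain ⟨i, hi⟩ := cs.exists_rightDescent_of_ne_one hne'
  have h2 := rep_nonpos cs hi
  rw [rep_mul, ← h, rep_inv_cancel] at h2
  have := h2 i
  rw [sr_same] at this
  norm_num at this

/-! ### Roots of reflections and the exchange property -/

/-- `γ` is a root of the reflection `t`. -/
def IsRt (cs : CoxeterSystem M W) (t : W) (γ : B → ℝ) : Prop :=
  ∃ w i, t = w * cs.simple i * w⁻¹ ∧ γ = rep cs w (sr i)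

theorem IsRt.refl {cs : CoxeterSystem M W} {t : W} {γ : B → ℝ} (h : IsRt cs t γ) :
    cs.IsReflection t := by
  obtain ⟨w, i, rfl, rfl⟩ := h
  exact ⟨w, i, rfl⟩

theorem IsRt.norm {cs : CoxeterSystem M W} {t : W} {γ : B → ℝ} (h : IsRt cs t γ) :
    bf M γ γ = 1 := by
  obtain ⟨w, i, rfl, rfl⟩ := h
  rw [bf_rep, bf_sr_self]

theorem IsRt.ne_zero {cs : CoxeterSystem M W} {t : W} {γ : B → ℝ} (h : IsRt cs t γ) :
    γ ≠ 0 := by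
  rintro rfl
  have := h.norm
  simp at this

theorem IsRt.apply {cs : CoxeterSystem M W} {t : W} {γ : B → ℝ} (h : IsRt cs t γ) (v : B → ℝ) :
    rep cs t v = v - (2 * bf M γ v) • γ := by
  obtain ⟨w, i, rfl, rfl⟩ := h
  rw [rep_mul, rep_mul, rep_simple, srefl_apply, map_sub, map_smul, rep_cancel_inv]
  rw [← bf_rep cs w (sr i), rep_cancel_inv]

theorem IsRt.neg {cs : CoxeterSystem M W} {t : W} {γ : B → ℝ} (h : IsRt cs t γ) :
    IsRt cs t (-γ) := by
  obtain ⟨w, i, rfl, rfl⟩ := h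
  refine ⟨w * cs.simple i, i, by simp [mul_assoc], ?_⟩
  rw [rep_mul, rep_simple, srefl_self, map_neg]

theorem IsRt.conj {cs : CoxeterSystem M W} {t : W} {γ : B → ℝ} (h : IsRt cs t γ) (g : W) :
    IsRt cs (g * t * g⁻¹) (rep cs g γ) := by
  obtain ⟨w, i, rfl, rfl⟩ := h
  exact ⟨g * w, i, by group, by rw [rep_mul]⟩

theorem IsRt.simple (cs : CoxeterSystem M W) (i : B) : IsRt cs (cs.simple i) (sr i) :=
  ⟨1, i, by simp, by simp⟩

theorem IsRt.sign {cs : CoxeterSystem M W} {t : W} {γ : B → ℝ} (h : IsRt cs t γ) :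
    0 ≤ γ ∨ γ ≤ 0 := by
  obtain ⟨w, i, rfl, rfl⟩ := h
  by_cases hd : cs.IsRightDescent w i
  · exact Or.inr (rep_nonpos cs hd)
  · exact Or.inl (rep_nonneg cs hd)

theorem IsRt.unique {cs : CoxeterSystem M W} {t t' : W} {γ : B → ℝ} (h : IsRt cs t γ)
    (h' : IsRt cs t' γ) : t = t' :=
  rep_injective cs fun v => by rw [h.apply, h'.apply]

theorem exists_rt (cs : CoxeterSystem M W) {t : W} (h : cs.IsReflection t) :
    ∃ γ, IsRt cs t γ ∧ 0 ≤ γ := by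
  obtain ⟨w, i, e⟩ := h
  have h1 : IsRt cs t (rep cs w (sr i)) := ⟨w, i, e, rfl⟩
  rcases h1.sign with h2 | h2
  · exact ⟨_, h1, h2⟩
  · exact ⟨_, h1.neg, by simpa using h2⟩

theorem exchange (cs : CoxeterSystem M W) {t : W} {γ : B → ℝ} (h : IsRt cs t γ) (hp : 0 ≤ γ)
    (ω : List B) (hn : rep cs (cs.wordProd ω) γ ≤ 0) :
    ∃ ω' : List B, ω'.Sublist ω ∧ ω'.length + 1 = ω.length ∧
      cs.wordProd ω' = cs.wordProd ω * t := by
  induction ω with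
  | nil =>
    exfalso
    simp at hn
    exact h.ne_zero (le_antisymm hn hp)
  | cons i ω ih =>
    have hδ := h.conj (cs.wordProd ω)
    set δ := rep cs (cs.wordProd ω) γ with hδe
    rcases hδ.sign with hs | hs
    · have h1 : srefl M i δ ≤ 0 := by
        rw [cs.wordProd_cons, rep_mul, rep_simple] at hn
        exact hn
      rw [srefl_apply] at h1
      have h2 : ∀ j, j ≠ i → δ j = 0 := by
        intro j hj
        have h3 := h1 j
        simp [sr_ne hj] at h3
        exact le_antisymm h3 (hs j)
      have h3 : δ = δ i • sr i := by
        ext j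
        by_cases hj : j = i
        · subst hj; simp [sr_same]
        · simp [sr_ne hj, h2 j hj]
      have h4 : δ i = 1 := by
        have h5 := hδ.norm
        rw [h3, map_smul, map_smul, LinearMap.smul_apply, bf_sr_self] at h5
        have h6 : 0 ≤ δ i := hs i
        simp at h5
        nlinarith
      rw [h4, one_smul] at h3
      rw [h3] at hδ
      have h5 := hδ.unique (IsRt.simple cs i)
      refine ⟨ω, List.sublist_cons_self i ω, by simp, ?_⟩
      rw [cs.wordProd_cons, mul_assoc]
      have h6 : cs.wordProd ω * t = cs.simple i * cs.wordProd ω := by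
        rw [← h5]; group
      rw [h6]; simp
    · obtain ⟨ω', a, b, c⟩ := ih hs
      exact ⟨i :: ω', a.cons_cons i, by simp [b], by
        rw [cs.wordProd_cons, c, cs.wordProd_cons, mul_assoc]⟩

theorem length_lt_of_nonpos (cs : CoxeterSystem M W) {t : W} {γ : B → ℝ} (h : IsRt cs t γ)
    (hp : 0 ≤ γ) {w : W} (hn : rep cs w γ ≤ 0) : cs.length (w * t) < cs.length w := by
  obtain ⟨ω, h1, rfl⟩ := cs.exists_isReduced w
  obtain ⟨ω', -, b, c⟩ := exchange cs h hp ω hn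
  have := cs.length_wordProd_le ω'
  rw [h1.eq, ← c]; omega

theorem IsRt.apply_self {cs : CoxeterSystem M W} {t : W} {γ : B → ℝ} (h : IsRt cs t γ) :
    rep cs t γ = -γ := by
  rw [h.apply, h.norm]; module

theorem lt_length_of_nonneg (cs : CoxeterSystem M W) {t : W} {γ : B → ℝ} (h : IsRt cs t γ)
    (hp : 0 ≤ γ) {w : W} (hn : 0 ≤ rep cs w γ) : cs.length w < cs.length (w * t) := by
  have h1 : rep cs (w * t) γ ≤ 0 := by
    rw [rep_mul, h.apply_self, map_neg]; simpa using hn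
  have h2 := length_lt_of_nonpos cs h hp h1
  rwa [mul_assoc, h.refl.mul_self, mul_one] at h2

theorem nonpos_of_length_lt (cs : CoxeterSystem M W) {t : W} {γ : B → ℝ} (h : IsRt cs t γ)
    (hp : 0 ≤ γ) {w : W} (hl : cs.length (w * t) < cs.length w) : rep cs w γ ≤ 0 := by
  rcases (h.conj w).sign with h1 | h1
  · have := lt_length_of_nonneg cs h hp h1; omega
  · exact h1

theorem strong_exchange (cs : CoxeterSystem M W) {t : W} (ht : cs.IsReflection t) (ω : List B)
    (hl : cs.length (cs.wordProd ω * t) < cs.length (cs.wordProd ω)) :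
    ∃ ω' : List B, ω'.Sublist ω ∧ ω'.length + 1 = ω.length ∧
      cs.wordProd ω' = cs.wordProd ω * t := by
  obtain ⟨γ, h, hp⟩ := exists_rt cs ht
  exact exchange cs h hp ω (nonpos_of_length_lt cs h hp hl)

theorem bruhatGen_sublist (cs : CoxeterSystem M W) {v w : W} (h : BruhatGen cs v w) (ω : List B)
    (hω : cs.wordProd ω = w) : ∃ ω' : List B, ω'.Sublist ω ∧ cs.wordProd ω' = v := by
  obtain ⟨h1, h2⟩ := h
  have e : cs.wordProd ω * (v⁻¹ * w) = v := by
    have h3 := h1.inv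
    rw [hω, ← h3]; group
  obtain ⟨ω', a, -, c⟩ := strong_exchange cs h1 ω (by rw [e, hω]; exact h2)
  exact ⟨ω', a, by rw [c, e]⟩

theorem bruhatLe_sublist (cs : CoxeterSystem M W) {v w : W} (h : BruhatLe cs v w) (ω : List B)
    (hω : cs.wordProd ω = w) : ∃ ω' : List B, ω'.Sublist ω ∧ cs.wordProd ω' = v := by
  induction h using Relation.ReflTransGen.head_induction_on with
  | refl => exact ⟨ω, List.Sublist.refl _, hω⟩
  | head h1 _ ih =>
    obtain ⟨ω', a, b⟩ := ih
    obtain ⟨ω'', a', b'⟩ := bruhatGen_sublist cs h1 ω' b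
    exact ⟨ω'', a'.trans a, b'⟩

set_option linter.unusedSectionVars false in
theorem bruhatLt_length (cs : CoxeterSystem M W) {v w : W} (h : BruhatLt cs v w) :
    cs.length v < cs.length w := by
  induction h with
  | single h => exact h.2
  | tail _ h ih => exact ih.trans h.2

theorem exists_reduced_sublist (cs : CoxeterSystem M W) (ω : List B) :
    ∃ ω' : List B, ω'.Sublist ω ∧ cs.IsReduced ω' ∧ cs.wordProd ω' = cs.wordProd ω := by
  induction ω with
  | nil => exact ⟨[], List.Sublist.refl _, by simp [CoxeterSystem.IsReduced], rfl⟩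
  | cons i ω ih =>
    obtain ⟨ω', a, b, c⟩ := ih
    rcases cs.length_simple_mul (cs.wordProd ω') i with h | h
    · refine ⟨i :: ω', a.cons_cons i, ?_, by rw [cs.wordProd_cons, cs.wordProd_cons, c]⟩
      unfold CoxeterSystem.IsReduced
      rw [cs.wordProd_cons, h, b.eq]; simp
    · have e : cs.wordProd ω' * ((cs.wordProd ω')⁻¹ * cs.simple i * (cs.wordProd ω')⁻¹⁻¹) =
          cs.simple i * cs.wordProd ω' := by group
      obtain ⟨ω'', a', b', c'⟩ := strong_exchange cs
        ((cs.isReflection_simple i).conj (cs.wordProd ω')⁻¹) ω' (by rw [e]; omega)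
      rw [e] at c'
      refine ⟨ω'', a'.trans (a.trans (List.sublist_cons_self i ω)), ?_, ?_⟩
      · unfold CoxeterSystem.IsReduced
        rw [c']
        have := b.eq
        omega
      · rw [c', cs.wordProd_cons, c]

/-! ### Supports -/

/-- `w - 1` maps into the span of the simple roots in `J`. -/
def Fixes (cs : CoxeterSystem M W) (J : Set B) (w : W) : Prop :=
  ∀ v : B → ℝ, ∀ i, i ∉ J → rep cs w v i = v i

theorem Fixes.mul {cs : CoxeterSystem M W} {J : Set B} {x y : W} (hx : Fixes cs J x)
    (hy : Fixes cs J y) : Fixes cs J (x * y) := by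
  intro v i hi
  rw [rep_mul, hx _ i hi, hy _ i hi]

theorem Fixes.simple {cs : CoxeterSystem M W} {J : Set B} {i : B} (hi : i ∈ J) :
    Fixes cs J (cs.simple i) := by
  intro v j hj
  have : j ≠ i := by rintro rfl; exact hj hi
  rw [rep_simple, srefl_apply]; simp [sr_ne this]

theorem Fixes.word {cs : CoxeterSystem M W} {J : Set B} {ω : List B} (h : ∀ i ∈ ω, i ∈ J) :
    Fixes cs J (cs.wordProd ω) := by
  induction ω with
  | nil => intro v i _; simp
  | cons i ω ih =>
    rw [cs.wordProd_cons]
    exact (Fixes.simple (h i (by simp))).mul (ih fun j hj => h j (by simp [hj]))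

theorem Fixes.reduced {cs : CoxeterSystem M W} {J : Set B} (ω : List B) (hr : cs.IsReduced ω)
    (h : Fixes cs J (cs.wordProd ω)) : ∀ i ∈ ω, i ∈ J := by
  induction ω using List.reverseRecOn with
  | nil => simp
  | append_singleton ω i ih =>
    have hr' : cs.IsReduced ω := by
      have := hr.take ω.length
      simpa using this
    have e : cs.wordProd (ω ++ [i]) * cs.simple i = cs.wordProd ω := by
      rw [cs.wordProd_append]; simp
    have hd : cs.IsRightDescent (cs.wordProd (ω ++ [i])) i := by
      unfold CoxeterSystem.IsRightDescent
      rw [e, hr.eq, hr'.eq]; simp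
    have hi : i ∈ J := by
      by_contra hi
      have h1 := h (sr i) i hi
      have h2 := rep_nonpos cs hd i
      rw [h1, sr_same] at h2
      norm_num at h2
    have h3 : Fixes cs J (cs.wordProd ω) := by
      rw [← e]; exact h.mul (Fixes.simple hi)
    intro j hj
    rcases List.mem_append.1 hj with hj | hj
    · exact ih hr' h3 j hj
    · simp at hj; subst hj; exact hi

theorem supp_reduced (cs : CoxeterSystem M W) (ω : List B) (hr : cs.IsReduced ω) :
    supp cs (cs.wordProd ω) = {i | i ∈ ω} := by
  ext i
  constructor
  · intro h; exact h ω hr rfl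
  · intro hi l hl e
    have h1 : Fixes cs {i | i ∈ l} (cs.wordProd ω) := by
      rw [← e]; exact Fixes.word fun _ h => h
    exact Fixes.reduced ω hr h1 i hi

theorem fixes_iff (cs : CoxeterSystem M W) (J : Set B) (w : W) :
    Fixes cs J w ↔ supp cs w ⊆ J := by
  obtain ⟨ω, hr, rfl⟩ := cs.exists_isReduced w
  rw [supp_reduced cs ω hr]
  exact ⟨fun h i hi => Fixes.reduced ω hr h i hi, fun h => Fixes.word fun i hi => h hi⟩

theorem bruhatLe_supp (cs : CoxeterSystem M W) {v w : W} (h : BruhatLe cs v w) :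
    supp cs v ⊆ supp cs w := by
  obtain ⟨ω, hr, rfl⟩ := cs.exists_isReduced w
  obtain ⟨ω', a, rfl⟩ := bruhatLe_sublist cs h ω rfl
  rw [supp_reduced cs ω hr, ← fixes_iff]
  exact Fixes.word fun i hi => a.subset hi

/-! ### Absolute length -/

theorem abs_exists (cs : CoxeterSystem M W) (w : W) :
    ∃ l : List W, (∀ t ∈ l, cs.IsReflection t) ∧ l.length = absLength cs w ∧ l.prod = w := by
  have hne : {k | ∃ l : List W, (∀ t ∈ l, cs.IsReflection t) ∧ l.length = k ∧
      l.prod = w}.Nonempty := by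
    obtain ⟨ω, -, rfl⟩ := cs.exists_isReduced w
    refine ⟨_, ω.map cs.simple, ?_, rfl, rfl⟩
    intro t ht
    obtain ⟨i, -, rfl⟩ := List.mem_map.1 ht
    exact cs.isReflection_simple i
  exact Nat.sInf_mem hne

theorem abs_le (cs : CoxeterSystem M W) {l : List W} (h : ∀ t ∈ l, cs.IsReflection t) :
    absLength cs l.prod ≤ l.length := Nat.sInf_le ⟨l, h, rfl, rfl⟩

theorem abs_mul_le (cs : CoxeterSystem M W) (x y : W) :
    absLength cs (x * y) ≤ absLength cs x + absLength cs y := by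
  obtain ⟨l, a, b, c⟩ := abs_exists cs x
  obtain ⟨l', a', b', c'⟩ := abs_exists cs y
  rw [← b, ← b', ← List.length_append, ← c, ← c', ← List.prod_append]
  apply abs_le
  intro t ht
  rcases List.mem_append.1 ht with h | h
  · exact a t h
  · exact a' t h

theorem abs_one (cs : CoxeterSystem M W) : absLength cs 1 = 0 := by
  have := abs_le cs (l := []) (by simp)
  simpa using this

theorem abs_refl_le (cs : CoxeterSystem M W) {t : W} (h : cs.IsReflection t) :
    absLength cs t ≤ 1 := by
  have := abs_le cs (l := [t]) (by simpa using h)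
  simpa using this

theorem abs_le_length (cs : CoxeterSystem M W) (w : W) : absLength cs w ≤ cs.length w := by
  obtain ⟨ω, hr, rfl⟩ := cs.exists_isReduced w
  rw [hr.eq]
  have := abs_le cs (l := ω.map cs.simple) (by
    intro t ht
    obtain ⟨i, -, rfl⟩ := List.mem_map.1 ht
    exact cs.isReflection_simple i)
  rw [List.length_map] at this
  exact this

theorem abs_sublist (cs : CoxeterSystem M W) {l' l : List B} (h : l'.Sublist l) :
    absLength cs ((cs.wordProd l')⁻¹ * cs.wordProd l) + l'.length ≤ l.length := by
  induction h with
  | slnil => simp [abs_one]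
  | @cons l' l i _ ih =>
    have e : (cs.wordProd l')⁻¹ * cs.wordProd (i :: l) =
      ((cs.wordProd l')⁻¹ * cs.simple i * (cs.wordProd l')⁻¹⁻¹) *
        ((cs.wordProd l')⁻¹ * cs.wordProd l) := by
      rw [cs.wordProd_cons]; group
    have h1 := abs_mul_le cs ((cs.wordProd l')⁻¹ * cs.simple i * (cs.wordProd l')⁻¹⁻¹)
      ((cs.wordProd l')⁻¹ * cs.wordProd l)
    have h2 := abs_refl_le cs ((cs.isReflection_simple i).conj (cs.wordProd l')⁻¹)
    rw [e]
    simp only [List.length_cons]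
    omega
  | @cons_cons l' l i _ ih =>
    have e : (cs.wordProd (i :: l'))⁻¹ * cs.wordProd (i :: l) =
        (cs.wordProd l')⁻¹ * cs.wordProd l := by
      rw [cs.wordProd_cons, cs.wordProd_cons]; group
    rw [e]; simp only [List.length_cons]; omega

/-- The moved space. -/
noncomputable def mov (cs : CoxeterSystem M W) (w : W) : Submodule ℝ (B → ℝ) :=
  LinearMap.range (rep cs w - 1)

theorem mem_mov (cs : CoxeterSystem M W) (w : W) (v : B → ℝ) : rep cs w v - v ∈ mov cs w :=
  ⟨v, by simp⟩

theorem mov_mul_le (cs : CoxeterSystem M W) (x y : W) :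
    mov cs (x * y) ≤ mov cs x ⊔ mov cs y := by
  rintro _ ⟨v, rfl⟩
  have e : (rep cs (x * y) - 1) v =
      (rep cs x (rep cs y v) - rep cs y v) + (rep cs y v - v) := by
    simp
  rw [e]
  exact Submodule.add_mem_sup (mem_mov cs x _) (mem_mov cs y v)

theorem finrank_mov_mul_le (cs : CoxeterSystem M W) (x y : W) :
    Module.finrank ℝ (mov cs (x * y)) ≤
      Module.finrank ℝ (mov cs x) + Module.finrank ℝ (mov cs y) :=
  (Submodule.finrank_mono (mov_mul_le cs x y)).trans
    (Submodule.finrank_add_le_finrank_add_finrank _ _)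

theorem finrank_mov_refl (cs : CoxeterSystem M W) {t : W} (h : cs.IsReflection t) :
    Module.finrank ℝ (mov cs t) ≤ 1 := by
  obtain ⟨γ, hγ, -⟩ := exists_rt cs h
  have h1 : mov cs t ≤ Submodule.span ℝ {γ} := by
    rintro _ ⟨v, rfl⟩
    rw [LinearMap.sub_apply, hγ.apply, Submodule.mem_span_singleton]
    exact ⟨-(2 * bf M γ v), by simp⟩
  exact (Submodule.finrank_mono h1).trans (finrank_span_singleton hγ.ne_zero).le

theorem finrank_mov_le (cs : CoxeterSystem M W) (w : W) :
    Module.finrank ℝ (mov cs w) ≤ absLength cs w := by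
  obtain ⟨l, a, b, rfl⟩ := abs_exists cs w
  rw [← b]
  clear b
  induction l with
  | nil => rw [mov, List.prod_nil, map_one, sub_self, LinearMap.range_zero, finrank_bot]; simp
  | cons t l ih =>
    rw [List.prod_cons, List.length_cons]
    have h1 := finrank_mov_mul_le cs t l.prod
    have h2 := finrank_mov_refl cs (a t (by simp))
    have h3 := ih fun s hs => a s (by simp [hs])
    omega

theorem fixed_of_nodup (cs : CoxeterSystem M W) (l : List B) (hl : l.Nodup) (v : B → ℝ)
    (hv : rep cs (cs.wordProd l) v = v) : ∀ i ∈ l, srefl M i v = v := by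
  induction l with
  | nil => simp
  | cons i l ih =>
    rw [List.nodup_cons] at hl
    rw [cs.wordProd_cons, rep_mul, rep_simple] at hv
    have hf : Fixes cs {j | j ∈ l} (cs.wordProd l) := Fixes.word fun _ h => h
    have h1 : rep cs (cs.wordProd l) v = v := by
      ext j
      by_cases hj : j = i
      · subst hj; exact hf v j hl.1
      · conv_rhs => rw [← hv, srefl_apply]
        simp [sr_ne hj]
    intro j hj
    rcases List.mem_cons.1 hj with rfl | hj
    · rw [h1] at hv; exact hv
    · exact ih hl.2 h1 j hj

theorem eq_zero_of_fixed [Finite W] (cs : CoxeterSystem M W) (v : B → ℝ)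
    (hv : ∀ i, srefl M i v = v) : v = 0 := by
  classical
  have := Fintype.ofFinite W
  have h1 : ∀ w, rep cs w v = v := by
    intro w
    induction w using cs.simple_induction_left with
    | one => simp
    | mul_simple_left x i ih => rw [rep_mul, ih, rep_simple, hv]
  set A : Module.End ℝ (B → ℝ) := ∑ w, rep cs w with hA
  have h2 : ∀ i, A (sr i) = 0 := by
    intro i
    have h3 : A * rep cs (cs.simple i) = A := by
      rw [hA, Finset.sum_mul]
      exact Fintype.sum_equiv (Equiv.mulRight (cs.simple i)) _ _ fun w => by simp
    have h4 : A (sr i) = - A (sr i) := by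
      conv_lhs => rw [← h3]
      rw [Module.End.mul_apply, rep_simple, srefl_self, map_neg]
    exact self_eq_neg.1 h4
  have h3 : A = 0 := by
    apply LinearMap.pi_ext'
    intro i
    ext1
    have := h2 i
    simp only [sr] at this
    simp only [LinearMap.comp_apply, LinearMap.coe_single, LinearMap.zero_apply]
    convert this
  have h4 : A v = (Fintype.card W : ℝ) • v := by
    rw [hA, LinearMap.sum_apply]
    simp [h1, ← Nat.cast_smul_eq_nsmul ℝ]
  rw [h3] at h4
  simpa using h4.symm

theorem finrank_mov_cox [Finite W] (cs : CoxeterSystem M W) (l : List B) (hl : l.Nodup)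
    (ha : ∀ i, i ∈ l) : Module.finrank ℝ (mov cs (cs.wordProd l)) = Fintype.card B := by
  have h1 : LinearMap.ker (rep cs (cs.wordProd l) - 1) = ⊥ := by
    rw [LinearMap.ker_eq_bot']
    intro v hv
    have hv' : rep cs (cs.wordProd l) v = v := by
      simpa [sub_eq_zero] using hv
    exact eq_zero_of_fixed cs v fun i => fixed_of_nodup cs l hl v hv' i (ha i)
  have h2 : mov cs (cs.wordProd l) = ⊤ := LinearMap.ker_eq_bot_iff_range_eq_top.1 h1
  rw [h2]; simp

theorem length_eq_card (l : List B) (hl : l.Nodup) (ha : ∀ i, i ∈ l) :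
    l.length = Fintype.card B := by
  classical
  rw [← List.toFinset_card_of_nodup hl]
  congr 1
  ext i; simp [ha]

theorem abs_cox [Finite W] (cs : CoxeterSystem M W) (l : List B) (hl : l.Nodup)
    (ha : ∀ i, i ∈ l) : absLength cs (cs.wordProd l) = Fintype.card B := by
  apply le_antisymm
  · rw [← length_eq_card l hl ha]
    exact (abs_le_length cs _).trans (cs.length_wordProd_le l)
  · rw [← finrank_mov_cox cs l hl ha]
    exact finrank_mov_le cs _

theorem absLe_trans (cs : CoxeterSystem M W) {u v c : W} (h1 : AbsLe cs u v) (h2 : AbsLe cs v c) :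
    AbsLe cs u c := by
  unfold AbsLe at *
  have h3 := abs_mul_le cs u (u⁻¹ * c)
  have h4 := abs_mul_le cs (u⁻¹ * v) (v⁻¹ * c)
  rw [mul_inv_cancel_left] at h3
  rw [show u⁻¹ * v * (v⁻¹ * c) = u⁻¹ * c by group] at h4
  omega

theorem absCovBy_absLe (cs : CoxeterSystem M W) {u v : W} (h : AbsCovBy cs u v) :
    AbsLe cs u v := by
  obtain ⟨h1, h2⟩ := h
  unfold AbsLe
  have h3 := abs_refl_le cs h1
  have h4 := abs_mul_le cs u (u⁻¹ * v)
  rw [mul_inv_cancel_left] at h4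
  omega

theorem mov_le [Finite W] (cs : CoxeterSystem M W) {c : W} (hc : IsStdCoxeterElement cs c)
    {u v : W} (h1 : AbsLe cs u v) (h2 : AbsLe cs v c) : mov cs u ≤ mov cs v := by
  obtain ⟨l, hl, ha, rfl⟩ := hc
  have a1 := abs_cox cs l hl ha
  have a2 := finrank_mov_cox cs l hl ha
  set c := cs.wordProd l
  have b1 := finrank_mov_mul_le cs v (v⁻¹ * c)
  rw [mul_inv_cancel_left] at b1
  have b2 := finrank_mov_le cs v
  have b3 := finrank_mov_le cs (v⁻¹ * c)
  have b4 := finrank_mov_le cs u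
  have b5 := finrank_mov_le cs (u⁻¹ * v)
  have c1 := mov_mul_le cs u (u⁻¹ * v)
  rw [mul_inv_cancel_left] at c1
  have c2 := Submodule.finrank_add_le_finrank_add_finrank (mov cs u) (mov cs (u⁻¹ * v))
  unfold AbsLe at h1 h2
  have c3 : mov cs v = mov cs u ⊔ mov cs (u⁻¹ * v) :=
    Submodule.eq_of_le_of_finrank_le c1 (by omega)
  rw [c3]; exact le_sup_left

theorem absLe_supp [Finite W] (cs : CoxeterSystem M W) {c : W} (hc : IsStdCoxeterElement cs c)
    {u v : W} (h1 : AbsLe cs u v) (h2 : AbsLe cs v c) : supp cs u ⊆ supp cs v := by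
  rw [← fixes_iff]
  have hv : Fixes cs (supp cs v) v := (fixes_iff cs _ v).2 (le_refl _)
  intro x i hi
  obtain ⟨z, hz⟩ := mov_le cs hc h1 h2 (mem_mov cs u x)
  have h3 := congrFun hz i
  simp [hv z i hi] at h3
  linarith

theorem ll_supp [Finite W] (cs : CoxeterSystem M W) {c : W} (hc : IsStdCoxeterElement cs c)
    {v w : W} (hw : AbsLe cs w c) (h : Ll cs v w) : AbsLe cs v c ∧ supp cs v = supp cs w := by
  induction h using Relation.ReflTransGen.head_induction_on with
  | refl => exact ⟨hw, rfl⟩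
  | @head a b h1 _ ih =>
    have h2 := absCovBy_absLe cs h1.1
    refine ⟨absLe_trans cs h2 ih.1, ?_⟩
    rw [← ih.2]
    apply Set.Subset.antisymm
    · exact absLe_supp cs hc h2 ih.1
    · exact bruhatLe_supp cs h1.2.to_reflTransGen

/-! ### Rank two -/

theorem rank_two_step (cs : CoxeterSystem M W) {y t t' : W} {α β : B → ℝ}
    (hα : IsRt cs t α) (hβ : IsRt cs t' β) (pα : 0 ≤ α) (pβ : 0 ≤ β)
    (nα : rep cs y α ≤ 0) (nβ : rep cs y β ≤ 0)
    (H1 : ¬ cs.length (y * (t * t')) < cs.length y)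
    (H2 : ¬ cs.length (y * (t' * t)) < cs.length y) :
    IsRt cs (t' * t * t') (rep cs (t' * t) α) ∧ 0 ≤ rep cs (t' * t) α ∧
      rep cs y (rep cs (t' * t) α) ≤ 0 := by
  have e1 : rep cs (t' * t) α = - rep cs t' α := by
    rw [rep_mul, hα.apply_self, map_neg]
  have hr := hα.conj t'
  rw [hβ.refl.inv] at hr
  have l1 := length_lt_of_nonpos cs hβ pβ nβ
  have s1 : rep cs t' α ≤ 0 := by
    rcases hr.sign with h | h
    · exfalso
      have h3 : rep cs (y * t') (rep cs t' α) ≤ 0 := by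
        rw [← rep_mul, mul_assoc, hβ.refl.mul_self, mul_one]; exact nα
      have l2 := length_lt_of_nonpos cs hr h h3
      have e : y * t' * (t' * t * t') = y * (t * t') := by
        rw [show y * t' * (t' * t * t') = y * (t' * t') * t * t' by group, hβ.refl.mul_self]
        group
      rw [e] at l2
      omega
    · exact h
  have s2 : 0 ≤ rep cs y (rep cs t' α) := by
    rcases (hr.conj y).sign with h | h
    · exact h
    · exfalso
      rw [← rep_mul] at h
      have l2 := length_lt_of_nonpos cs hα pα h
      rw [mul_assoc] at l2
      omega
  rw [e1]
  exact ⟨hr.neg, by simpa using s1, by simpa using s2⟩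

theorem rank_two_all (cs : CoxeterSystem M W) {y : W} (k : ℕ) : ∀ {t t' : W} {α β : B → ℝ},
    IsRt cs t α → IsRt cs t' β → 0 ≤ α → 0 ≤ β →
    rep cs y α ≤ 0 → rep cs y β ≤ 0 →
    ¬ cs.length (y * (t * t')) < cs.length y →
    ¬ cs.length (y * (t' * t)) < cs.length y →
    0 ≤ rep cs ((t' * t) ^ k) α ∧ 0 ≤ rep cs ((t' * t) ^ k) β := by
  induction k with
  | zero => intro t t' α β _ _ pα pβ _ _ _ _; simp [pα, pβ]
  | succ k ih =>
    intro t t' α β hα hβ pα pβ nα nβ H1 H2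
    obtain ⟨a1, a2, a3⟩ := rank_two_step cs hα hβ pα pβ nα nβ H1 H2
    have q : t' * t' = 1 := hβ.refl.mul_self
    have q2 : t * t = 1 := hα.refl.mul_self
    have e1 : t' * (t' * t * t') = t * t' := by
      rw [show t' * (t' * t * t') = (t' * t') * t * t' by group, q]; group
    have e2 : (t' * t * t') * t' = t' * t := by
      rw [mul_assoc, q, mul_one]
    obtain ⟨b1, b2, b3⟩ := rank_two_step cs hβ a1 pβ a2 nβ a3 (by rwa [e1]) (by rwa [e2])
    rw [e2] at b1 b2 b3
    have e3 : (t' * t * (t' * t * t')) * (t' * t * t') = t' * t := by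
      rw [mul_assoc, a1.refl.mul_self, mul_one]
    have e4 : (t' * t * t') * (t' * t * (t' * t * t')) = t * t' := by
      rw [show (t' * t * t') * (t' * t * (t' * t * t')) =
        t' * t * (t' * t') * (t * t') * (t * t') by group, q,
        show t' * t * 1 * (t * t') * (t * t') = t' * (t * t) * t' * (t * t') by group, q2,
        show t' * 1 * t' * (t * t') = t' * t' * (t * t') by group, q, one_mul]
    have := ih a1 b1 a2 b2 a3 b3 (by rwa [e4]) (by rwa [e3])
    rw [e3] at this
    rw [pow_succ, rep_mul cs _ (t' * t) α, rep_mul cs _ (t' * t) β]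
    exact this

theorem rank_two [Finite W] (cs : CoxeterSystem M W) {y t t' : W} (ht : cs.IsReflection t)
    (ht' : cs.IsReflection t') (hne : t ≠ t') (h1 : cs.length (y * t) < cs.length y)
    (h2 : cs.length (y * t') < cs.length y) :
    cs.length (y * (t * t')) < cs.length y ∨ cs.length (y * (t' * t)) < cs.length y := by
  by_contra hcon
  push Not at hcon
  obtain ⟨α, hα, pα⟩ := exists_rt cs ht
  obtain ⟨β, hβ, pβ⟩ := exists_rt cs ht'
  have all := fun k => rank_two_all cs (y := y) k hα hβ pα pβ
    (nonpos_of_length_lt cs hα pα h1) (nonpos_of_length_lt cs hβ pβ h2)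
    (not_lt.2 hcon.1) (not_lt.2 hcon.2)
  set r := t' * t with hr
  set b := 2 * bf M α β with hb
  have ra : rep cs r α = b • β - α := by
    rw [hr, rep_mul, hα.apply_self, map_neg, hβ.apply, bf_symm M β α]; module
  have rb : rep cs r β = b • rep cs r α - β := by
    have e : rep cs r β = b • (b • β - α) - β := by
      rw [hr, rep_mul, hα.apply, map_sub, map_smul, hβ.apply_self, hβ.apply, bf_symm M β α]
      module
    rw [e, ra]
  obtain ⟨N, hN, hrN⟩ := isOfFinOrder_iff_pow_eq_one.1 (isOfFinOrder_of_finite r)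
  -- summation
  set A : Module.End ℝ (B → ℝ) := ∑ k ∈ Finset.range N, rep cs (r ^ k) with hA
  have Ar : ∀ v, A (rep cs r v) = A v := by
    intro v
    have h3 : (∑ k ∈ Finset.range N, rep cs (r ^ (k + 1)) v) =
        ∑ k ∈ Finset.range N, rep cs (r ^ k) v := by
      have s1 := Finset.sum_range_succ (fun k => rep cs (r ^ k) v) N
      have s2 := Finset.sum_range_succ' (fun k => rep cs (r ^ k) v) N
      rw [s1, hrN] at s2
      simp only [pow_zero] at s2
      exact (add_right_cancel s2).symm
    rw [hA, LinearMap.sum_apply, LinearMap.sum_apply, ← h3]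
    refine Finset.sum_congr rfl fun k _ => ?_
    rw [pow_succ, rep_mul cs (r ^ k) r v]
  have Age : ∀ v : B → ℝ, (∀ k, 0 ≤ rep cs (r ^ k) v) → v ≤ A v := by
    intro v hv
    have h3 := Finset.single_le_sum (f := fun k => rep cs (r ^ k) v) (s := Finset.range N)
      (fun k _ => hv k) (Finset.mem_range.2 hN)
    rw [hA, LinearMap.sum_apply]
    simpa using h3
  have A1 : (2 : ℝ) • A α = b • A β := by
    have := Ar α
    rw [ra, map_sub, map_smul] at this
    rw [two_smul]
    exact (sub_eq_iff_eq_add.1 this).symm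
  have A2 : (2 : ℝ) • A β = b • A α := by
    have := Ar β
    rw [rb, map_sub, map_smul, Ar] at this
    rw [two_smul]
    exact (sub_eq_iff_eq_add.1 this).symm
  have gα := Age α fun k => (all k).1
  have gβ := Age β fun k => (all k).2
  obtain ⟨i, hi⟩ : ∃ i, α i ≠ 0 := by
    by_contra hall
    push Not at hall
    exact hα.ne_zero (funext hall)
  have k1 : 0 < A α i := lt_of_lt_of_le (lt_of_le_of_ne (pα i) hi.symm) (gα i)
  have k2 : 0 ≤ A β i := (pβ i).trans (gβ i)
  have m1 : 2 * A α i = b * A β i := by simpa using congrFun A1 i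
  have m2 : 2 * A β i = b * A α i := by simpa using congrFun A2 i
  have hb2 : b = 2 := by
    have h3 : (b ^ 2 - 4) * A α i = 0 := by linear_combination (-2) * m1 - b * m2
    have h4 : b ^ 2 - 4 = 0 := by
      rcases mul_eq_zero.1 h3 with h | h
      · exact h
      · exact absurd h k1.ne'
    have h5 : 0 ≤ b := by
      by_contra hneg
      push Not at hneg
      nlinarith
    nlinarith
  rw [hb2] at ra rb
  have fd : rep cs r (β - α) = β - α := by rw [map_sub, rb, ra]; module
  have pw : ∀ k : ℕ, rep cs (r ^ k) α = α + (2 * (k : ℝ)) • (β - α) := by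
    intro k
    induction k with
    | zero => simp
    | succ k ih =>
      rw [pow_succ', rep_mul, ih, map_add, map_smul, fd, ra]
      push_cast
      module
  have h6 := pw N
  rw [hrN] at h6
  have h7 : (2 * (N : ℝ)) • (β - α) = 0 := by simpa using h6
  have h8 : β - α = 0 := by
    rcases smul_eq_zero.1 h7 with h | h
    · have : (0 : ℝ) < N := by exact_mod_cast hN
      exact absurd h (by positivity)
    · exact h
  have h9 : β = α := sub_eq_zero.1 h8
  rw [h9] at hβ
  exact hne (hα.unique hβ)

/-! ### Chains -/

/-- The total length of the chain starting at `x` with steps `L`. -/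
noncomputable def wt (cs : CoxeterSystem M W) : W → List W → ℕ
  | _, [] => 0
  | x, t :: L => cs.length (x * t) + wt cs (x * t) L

theorem up_chain [Finite W] (cs : CoxeterSystem M W) (L : List W) : ∀ (x t : W),
    (∀ s ∈ t :: L, cs.IsReflection s) →
    (∀ L' : List W, (∀ s ∈ L', cs.IsReflection s) → L'.length = (t :: L).length →
      L'.prod = (t :: L).prod → wt cs x (t :: L) ≤ wt cs x L') →
    absLength cs (t :: L).prod = (t :: L).length →
    cs.length x < cs.length (x * t) → BruhatLe cs x (x * (t :: L).prod) := by
  induction L with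
  | nil =>
    intro x t hr _ _ hl
    refine Relation.ReflTransGen.single ⟨?_, ?_⟩
    · simpa using hr t (by simp)
    · simpa using hl
  | cons t2 L ih =>
    intro x t hr hmin habs hl
    have ht := hr t (by simp)
    have ht2 := hr t2 (by simp)
    have hL : ∀ s ∈ L, cs.IsReflection s := fun s hs => hr s (by simp [hs])
    have hne : t ≠ t2 := by
      rintro rfl
      have h1 : (t :: t :: L).prod = L.prod := by
        rw [List.prod_cons, List.prod_cons, ← mul_assoc, ht.mul_self, one_mul]
      rw [h1] at habs
      have := abs_le cs hL
      simp only [List.length_cons] at habs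
      omega
    have hstep : BruhatGen cs x (x * t) := ⟨by simpa using ht, hl⟩
    have hswap : ∀ u u' : W, cs.IsReflection u → cs.IsReflection u' → u * u' = t * t2 →
        cs.length (x * t) ≤ cs.length (x * u) := by
      intro u u' hu hu' he
      have h1 := hmin (u :: u' :: L) (by
        intro s hs
        rcases List.mem_cons.1 hs with rfl | hs
        · exact hu
        rcases List.mem_cons.1 hs with rfl | hs
        · exact hu'
        exact hL s hs) (by simp) (by
        simp only [List.prod_cons, ← mul_assoc, he])
      simp only [wt] at h1
      rw [mul_assoc x t t2, mul_assoc x u u', he] at h1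
      omega
    have hup : cs.length (x * t) < cs.length (x * t * t2) := by
      by_contra hcon
      have hlt : cs.length (x * t * t2) < cs.length (x * t) :=
        lt_of_le_of_ne (not_lt.1 hcon) (ht2.length_mul_left_ne _)
      have hx : x * t * t = x := by rw [mul_assoc, ht.mul_self, mul_one]
      rcases rank_two cs (y := x * t) ht ht2 hne (by rw [hx]; exact hl) hlt with h | h
      · have h1 := hswap t2 (t2 * t * t2⁻¹) ht2 (ht.conj t2) (by
          rw [ht2.inv, show t2 * (t2 * t * t2) = (t2 * t2) * t * t2 by group, ht2.mul_self]
          group)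
        rw [← mul_assoc, hx] at h
        omega
      · have h1 := hswap (t * t2 * t⁻¹) t (ht2.conj t) ht (by group)
        rw [ht.inv] at h1
        rw [show x * t * (t2 * t) = x * (t * t2 * t) by group] at h
        omega
    have h3 := ih (x * t) t2 (fun s hs => hr s (by simp at hs ⊢; tauto)) (by
      intro L' hL' hlen hprod
      have h1 := hmin (t :: L') (by
        intro s hs
        rcases List.mem_cons.1 hs with rfl | hs
        · exact ht
        exact hL' s hs) (by simp [hlen]) (by rw [List.prod_cons, hprod, ← List.prod_cons])
      have w1 : wt cs x (t :: t2 :: L) = cs.length (x * t) + wt cs (x * t) (t2 :: L) := rfl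
      have w2 : wt cs x (t :: L') = cs.length (x * t) + wt cs (x * t) L' := rfl
      rw [w1, w2] at h1
      omega) (by
      have h1 := abs_mul_le cs t (t2 :: L).prod
      have h2 := abs_refl_le cs ht
      have h4 := abs_le cs (l := t2 :: L) (fun s hs => hr s (by simp at hs ⊢; tauto))
      rw [List.prod_cons] at habs
      simp only [List.length_cons] at habs h4 ⊢
      omega) hup
    rw [List.prod_cons, ← mul_assoc]
    exact Relation.ReflTransGen.head hstep h3

theorem exists_min_chain (cs : CoxeterSystem M W) (x k : W) : ∃ L : List W,
    (∀ s ∈ L, cs.IsReflection s) ∧ L.length = absLength cs k ∧ L.prod = k ∧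
    (∀ L' : List W, (∀ s ∈ L', cs.IsReflection s) → L'.length = L.length →
      L'.prod = L.prod → wt cs x L ≤ wt cs x L') := by
  classical
  have hex : ∃ n, ∃ L : List W, ((∀ s ∈ L, cs.IsReflection s) ∧ L.length = absLength cs k ∧
      L.prod = k) ∧ wt cs x L = n := by
    obtain ⟨L, hL⟩ := abs_exists cs k
    exact ⟨_, L, hL, rfl⟩
  obtain ⟨L, ⟨h1, h2, h3⟩, h4⟩ := Nat.find_spec hex
  refine ⟨L, h1, h2, h3, ?_⟩
  intro L' a b c
  rw [h4]
  exact Nat.find_min' hex ⟨L', ⟨a, by omega, by rw [c, h3]⟩, rfl⟩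

theorem exists_top [Finite W] (cs : CoxeterSystem M W) {c : W} (n : ℕ) : ∀ w : W,
    absLength cs (w⁻¹ * c) = n → AbsLe cs w c →
    ∃ m, Ll cs w m ∧ AbsLe cs m c ∧ BruhatLe cs m c := by
  induction n with
  | zero =>
    intro w hn hw
    obtain ⟨L, h1, h2, h3⟩ := abs_exists cs (w⁻¹ * c)
    rw [hn] at h2
    have h4 : w = c := by
      rw [List.length_eq_zero_iff.1 h2] at h3
      exact inv_mul_eq_one.1 h3.symm
    subst h4
    exact ⟨w, Relation.ReflTransGen.refl, hw, Relation.ReflTransGen.refl⟩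
  | succ n ih =>
    intro w hn hw
    obtain ⟨L, h1, h2, h3, h4⟩ := exists_min_chain cs w (w⁻¹ * c)
    rw [hn] at h2
    cases L with
    | nil => simp at h2
    | cons t L =>
      have ht := h1 t (by simp)
      by_cases hl : cs.length w < cs.length (w * t)
      · have := up_chain cs L w t h1 h4 (by rw [h3, hn, h2]) hl
        rw [h3, mul_inv_cancel_left] at this
        exact ⟨w, Relation.ReflTransGen.refl, hw, this⟩
      · have hlt : cs.length (w * t) < cs.length w :=
          lt_of_le_of_ne (not_lt.1 hl) (ht.length_mul_left_ne _)
        have e : (w * t)⁻¹ * c = L.prod := by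
          rw [List.prod_cons] at h3
          rw [mul_inv_rev, mul_assoc, ← h3, inv_mul_cancel_left]
        have a1 := abs_le cs (l := L) (fun s hs => h1 s (by simp [hs]))
        have a2 := abs_mul_le cs t L.prod
        have a3 := abs_refl_le cs ht
        have a4 := abs_mul_le cs w t
        have a5 := abs_mul_le cs (w * t) L.prod
        rw [← e, mul_inv_cancel_left] at a5
        rw [← List.prod_cons, h3, hn] at a2
        rw [e] at a5
        simp only [List.length_cons] at h2
        unfold AbsLe at hw
        have hwt : AbsLe cs (w * t) c := by
          unfold AbsLe; rw [e]; omega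
        have hgen : LlGen cs w (w * t) := by
          refine ⟨⟨by simpa using ht, by omega⟩, Relation.TransGen.single ⟨?_, hlt⟩⟩
          have : (w * t)⁻¹ * w = t⁻¹ := by group
          rw [this, ht.inv]; exact ht
        obtain ⟨m, b1, b2, b3⟩ := ih (w * t) (by rw [e]; omega) hwt
        exact ⟨m, Relation.ReflTransGen.head hgen b1, b2, b3⟩

/-! ### Interval partitions -/

theorem interval_word (cs : CoxeterSystem M W) (l : List B) (hl : l.Nodup) {w : W}
    (hw : BruhatLe cs w (cs.wordProd l)) :
    ∃ l' : List B, l'.Sublist l ∧ l'.Nodup ∧ cs.IsReduced l' ∧ cs.wordProd l' = w ∧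
      supp cs w = {i | i ∈ l'} := by
  obtain ⟨l1, a1, rfl⟩ := bruhatLe_sublist cs hw l rfl
  obtain ⟨l2, a2, b2, c2⟩ := exists_reduced_sublist cs l1
  refine ⟨l2, a2.trans a1, hl.sublist (a2.trans a1), b2, c2, ?_⟩
  rw [← c2, supp_reduced cs l2 b2]

set_option linter.unusedSectionVars false in
theorem sublist_unique (l : List B) (hl : l.Nodup) {l1 l2 : List B} (h1 : l1.Sublist l)
    (h2 : l2.Sublist l) (h : ∀ i, i ∈ l1 ↔ i ∈ l2) : l1 = l2 := by
  classical
  induction l generalizing l1 l2 with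
  | nil => rw [List.sublist_nil.1 h1, List.sublist_nil.1 h2]
  | cons a l ih =>
    rw [List.nodup_cons] at hl
    have key : ∀ {m : List B}, m.Sublist l → a ∉ m := fun hm ha => hl.1 (hm.subset ha)
    rcases List.sublist_cons_iff.1 h1 with g1 | ⟨r1, rfl, g1⟩ <;>
    rcases List.sublist_cons_iff.1 h2 with g2 | ⟨r2, rfl, g2⟩
    · exact ih hl.2 g1 g2 h
    · exact absurd ((h a).2 (by simp)) (key g1)
    · exact absurd ((h a).1 (by simp)) (key g2)
    · congr 1
      refine ih hl.2 g1 g2 fun i => ?_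
      have := h i
      by_cases hi : i = a
      · subst hi; simp [key g1, key g2]
      · simpa [hi] using this

theorem interval_unique (cs : CoxeterSystem M W) {c : W} (hc : IsStdCoxeterElement cs c)
    {v w : W} (hv : BruhatLe cs v c) (hw : BruhatLe cs w c) (h : supp cs v = supp cs w) :
    v = w := by
  obtain ⟨l, hl, -, rfl⟩ := hc
  obtain ⟨l1, a1, -, -, d1, e1⟩ := interval_word cs l hl hv
  obtain ⟨l2, a2, -, -, d2, e2⟩ := interval_word cs l hl hw
  rw [← d1, ← d2, sublist_unique l hl a1 a2]
  intro i
  have : i ∈ supp cs v ↔ i ∈ supp cs w := by rw [h]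
  rw [e1, e2] at this
  exact this

theorem supp_card_le (cs : CoxeterSystem M W) (w : W) : (supp cs w).ncard ≤ cs.length w := by
  classical
  obtain ⟨ω, hr, rfl⟩ := cs.exists_isReduced w
  rw [supp_reduced cs ω hr, hr.eq]
  have : {i | i ∈ ω} = (ω.toFinset : Set B) := by ext; simp
  rw [this, Set.ncard_coe_finset]
  exact List.toFinset_card_le ω

theorem interval_length (cs : CoxeterSystem M W) {c : W} (hc : IsStdCoxeterElement cs c)
    {w : W} (hw : BruhatLe cs w c) : cs.length w = (supp cs w).ncard := by
  classical
  obtain ⟨l, hl, -, rfl⟩ := hc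
  obtain ⟨l1, a1, b1, c1, d1, e1⟩ := interval_word cs l hl hw
  rw [e1, ← d1, c1.eq]
  have : {i | i ∈ l1} = (l1.toFinset : Set B) := by ext; simp
  rw [this, Set.ncard_coe_finset, List.toFinset_card_of_nodup b1]

theorem exists_supp [Finite W] (cs : CoxeterSystem M W) {c : W} (hc : IsStdCoxeterElement cs c)
    (J : Set B) : ∃ w : W, AbsLe cs w c ∧ supp cs w = J := by
  classical
  obtain ⟨l, hl, ha, rfl⟩ := hc
  set l' := l.filter (fun i => decide (i ∈ J)) with hl'
  have hs : l'.Sublist l := List.filter_sublist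
  have h1 := abs_sublist cs hs
  have h2 := abs_cox cs l hl ha
  have h3 := length_eq_card l hl ha
  have h4 := abs_mul_le cs (cs.wordProd l') ((cs.wordProd l')⁻¹ * cs.wordProd l)
  rw [mul_inv_cancel_left] at h4
  have h5 := abs_le_length cs (cs.wordProd l')
  have h6 := cs.length_wordProd_le l'
  refine ⟨cs.wordProd l', by unfold AbsLe; omega, ?_⟩
  rw [supp_reduced cs l' (by unfold CoxeterSystem.IsReduced; omega)]
  ext i
  simp [hl', ha]

end rep

/-- Proposition 4.8: `v ≪ w` implies `supp v = supp w`; the connected components of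
`(NC(W,c), ≪)` are exactly the `2^n` sets of noncrossing partitions with a fixed
support, and interval partitions are the maximal elements for `≪`. -/
theorem stmt15 [Finite W] [Fintype B] (cs : CoxeterSystem M W) (c : W)
    (hc : IsStdCoxeterElement cs c) :
    (∀ v w : W, AbsLe cs w c → Ll cs v w → supp cs v = supp cs w) ∧
    (∀ v w : W, AbsLe cs v c → AbsLe cs w c →
      (Relation.ReflTransGen
          (fun a b => (AbsLe cs a c ∧ AbsLe cs b c) ∧ (Ll cs a b ∨ Ll cs b a)) v w ↔
        supp cs v = supp cs w)) ∧
    (Nat.card {J : Set B // ∃ w : W, AbsLe cs w c ∧ supp cs w = J} =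
      2 ^ Fintype.card B) ∧
    (∀ w : W, AbsLe cs w c → BruhatLe cs w c →
      ∀ v : W, AbsLe cs v c → Ll cs w v → v = w) := by
  refine ⟨fun v w hw h => (ll_supp cs hc hw h).2, ?_, ?_, ?_⟩
  · intro v w hv hw
    constructor
    · intro h
      induction h with
      | refl => rfl
      | tail _ h ih =>
        obtain ⟨⟨ha, hb⟩, h⟩ := h
        rw [ih ha]
        rcases h with h | h
        · exact (ll_supp cs hc hb h).2
        · exact (ll_supp cs hc ha h).2.symm
    · intro h
      obtain ⟨m, a1, a2, a3⟩ := exists_top cs _ v rfl hv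
      obtain ⟨m', b1, b2, b3⟩ := exists_top cs _ w rfl hw
      have e : m = m' := interval_unique cs hc a3 b3 (by
        rw [← (ll_supp cs hc a2 a1).2, ← (ll_supp cs hc b2 b1).2, h])
      subst e
      exact Relation.ReflTransGen.head ⟨⟨hv, a2⟩, Or.inl a1⟩
        (Relation.ReflTransGen.single ⟨⟨a2, hw⟩, Or.inr b1⟩)
  · have e : {J : Set B // ∃ w : W, AbsLe cs w c ∧ supp cs w = J} ≃ Set B :=
      Equiv.subtypeUnivEquiv fun J => exists_supp cs hc J
    rw [Nat.card_congr e, Nat.card_eq_fintype_card, Fintype.card_set]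
  · intro w hw hwc v hv h
    rcases Relation.ReflTransGen.cases_head h with h | ⟨w1, h1, h2⟩
    · exact h.symm
    · exfalso
      have s1 := (ll_supp cs hc hv h).2
      have s2 := (ll_supp cs hc hv h2).2
      have l1 := bruhatLt_length cs h1.2
      have l2 := supp_card_le cs w1
      have l3 := interval_length cs hc hwc
      rw [s2, ← s1] at l2
      omega

end NCpaper
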